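/- Let A be next to free minus, so that A is strictly plus-one generated with POexp(A) = (d_1,…,d_ℓ) and level d. If d > d_i for all i, then A admits exactly one free addition, i.e., there is a unique hyperplane H ∉ A such that A ∪ {H} is free. -/

import Mathlib

open MvPolynomial

noncomputable section

attribute [local instance] Classical.propDecidable

namespace ArrPOG

variable (K : Type) [Field K] (ℓ : ℕ)

/-- A polynomial vector field on `K^ℓ`: `θ = Σ θᵢ ∂/∂xᵢ`, identified with its
coefficient vector `(θ₁,…,θ_ℓ)` in `S = K[x₁,…,x_ℓ]`. -/
abbrev Deriv : Type := Fin ℓ → MvPolynomial (Fin ℓ) K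

variable {K ℓ}

/-- The linear polynomial `α_H ∈ S` associated to a linear form `φ ∈ V*`. -/
def linPoly (φ : Module.Dual K (Fin ℓ → K)) : MvPolynomial (Fin ℓ) K :=
  ∑ i, MvPolynomial.C (φ (Pi.single i 1)) * MvPolynomial.X i

/-- `θ(α)` for a derivation `θ` and the linear form `α` given by `φ ∈ V*`. -/
def applyLin (θ : Deriv K ℓ) (φ : Module.Dual K (Fin ℓ → K)) : MvPolynomial (Fin ℓ) K :=
  ∑ i, MvPolynomial.C (φ (Pi.single i 1)) * θ i

/-- An arrangement: a finite set of hyperplanes (kernels of nonzero linear forms). -/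
def IsArrangement (A : Finset (Submodule K (Fin ℓ → K))) : Prop :=
  ∀ H ∈ A, ∃ φ : Module.Dual K (Fin ℓ → K), φ ≠ 0 ∧ LinearMap.ker φ = H

/-- Essential: the common intersection of all members is `0`. -/
def Essential (A : Finset (Submodule K (Fin ℓ → K))) : Prop :=
  A.inf id = ⊥

/-- Membership in the logarithmic derivation module `D(A)`:
`θ(α_H) ∈ S·α_H` for every `H ∈ A`. -/
def InD (A : Finset (Submodule K (Fin ℓ → K))) (θ : Deriv K ℓ) : Prop :=
  ∀ H ∈ A, ∀ φ : Module.Dual K (Fin ℓ → K), LinearMap.ker φ = H → linPoly φ ∣ applyLin θ φ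

/-- A derivation is homogeneous of degree `n` if all its coefficients are. -/
def HomogDeriv (θ : Deriv K ℓ) (n : ℕ) : Prop := ∀ i, (θ i).IsHomogeneous n

/-- `θ₁,…,θₙ` generate `D(A)` as an `S`-module. -/
def GeneratesD {n : ℕ} (A : Finset (Submodule K (Fin ℓ → K))) (θ : Fin n → Deriv K ℓ) : Prop :=
  (∀ i, InD A (θ i)) ∧
    ∀ η, InD A η → ∃ c : Fin n → MvPolynomial (Fin ℓ) K, η = ∑ i, c i • θ i

/-- `S`-linear independence of a family of derivations. -/
def IndepD {n : ℕ} (θ : Fin n → Deriv K ℓ) : Prop :=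
  ∀ c : Fin n → MvPolynomial (Fin ℓ) K, (∑ i, c i • θ i) = 0 → ∀ i, c i = 0

/-- `A` is free with exponents `e`: `D(A)` has a homogeneous basis of degrees `e i`. -/
def IsFreeExp (A : Finset (Submodule K (Fin ℓ → K))) (e : Fin ℓ → ℕ) : Prop :=
  ∃ θ : Fin ℓ → Deriv K ℓ, (∀ i, HomogDeriv (θ i) (e i)) ∧ GeneratesD A θ ∧ IndepD θ

/-- `A` is free. -/
def IsFree (A : Finset (Submodule K (Fin ℓ → K))) : Prop := ∃ e, IsFreeExp A e

/-- `A` is plus-one generated with exponents `e`, level `lev`, realized by the minimal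
homogeneous generators `θ₁,…,θ_ℓ, φ` whose unique syzygy is `Σ fᵢ•θᵢ + α•φ = 0`:
this encodes the minimal free resolution
`0 → S[-lev-1] → S[-lev] ⊕ (⊕ S[-eᵢ]) → D(A) → 0`. -/
def IsPOGWith (A : Finset (Submodule K (Fin ℓ → K))) (e : Fin ℓ → ℕ) (lev : ℕ)
    (θ : Fin ℓ → Deriv K ℓ) (φ : Deriv K ℓ)
    (f : Fin ℓ → MvPolynomial (Fin ℓ) K) (α : MvPolynomial (Fin ℓ) K) : Prop :=
  (∀ i, InD A (θ i)) ∧ InD A φ ∧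
  (∀ i, HomogDeriv (θ i) (e i)) ∧ HomogDeriv φ lev ∧
  (∀ η, InD A η → ∃ (c : Fin ℓ → MvPolynomial (Fin ℓ) K) (g : MvPolynomial (Fin ℓ) K),
      η = (∑ i, c i • θ i) + g • φ) ∧
  α.IsHomogeneous 1 ∧
  (∀ i, (f i).IsHomogeneous (lev + 1 - e i)) ∧
  (∀ i, MvPolynomial.constantCoeff (f i) = 0) ∧
  ((∑ i, f i • θ i) + α • φ = 0) ∧
  (¬ (α = 0 ∧ ∀ i, f i = 0)) ∧
  (∀ (g : Fin ℓ → MvPolynomial (Fin ℓ) K) (h : MvPolynomial (Fin ℓ) K),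
      ((∑ i, g i • θ i) + h • φ = 0) →
      ∃ q : MvPolynomial (Fin ℓ) K, (∀ i, g i = q * f i) ∧ h = q * α)

/-- Plus-one generated with exponents `e` and level `lev`. -/
def IsPOG (A : Finset (Submodule K (Fin ℓ → K))) (e : Fin ℓ → ℕ) (lev : ℕ) : Prop :=
  ∃ θ φ f α, IsPOGWith A e lev θ φ f α

/-- Strictly plus-one generated: the level coefficient `α` is nonzero. -/
def IsSPOG (A : Finset (Submodule K (Fin ℓ → K))) (e : Fin ℓ → ℕ) (lev : ℕ) : Prop :=
  ∃ θ φ f α, IsPOGWith A e lev θ φ f α ∧ α ≠ 0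

/-- The restriction `A^H = {L ⊓ H | L ∈ A \ {H}}`. -/
def restrict (A : Finset (Submodule K (Fin ℓ → K))) (H : Submodule K (Fin ℓ → K)) :
    Finset (Submodule K (Fin ℓ → K)) :=
  (A.erase H).image (fun L => L ⊓ H)

/-- The localization `A_X = {L ∈ A | X ⊆ L}`. -/
def localize (A : Finset (Submodule K (Fin ℓ → K))) (X : Submodule K (Fin ℓ → K)) :
    Finset (Submodule K (Fin ℓ → K)) :=
  A.filter (fun L => X ≤ L)

/-- The intersection lattice of `A`, inside the ambient space `T`. -/
def latticeOf (T : Submodule K (Fin ℓ → K)) (A : Finset (Submodule K (Fin ℓ → K))) :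
    Finset (Submodule K (Fin ℓ → K)) :=
  A.powerset.image (fun B => T ⊓ B.inf id)

/-- The Möbius function of the poset `L` (intersection lattice with top `T`). -/
def mob (T : Submodule K (Fin ℓ → K)) (L : Finset (Submodule K (Fin ℓ → K)))
    (X : Submodule K (Fin ℓ → K)) : ℤ :=
  if X = T then 1
  else - ∑ Y ∈ (L.filter fun Z => X < Z).attach, mob T L Y.1
termination_by (L.filter fun Z => X < Z).card
decreasing_by
  obtain ⟨Y, hY⟩ := Y
  simp only [Finset.mem_filter] at hY
  apply Finset.card_lt_card
  rw [Finset.ssubset_def]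
  constructor
  · intro Z hZ
    simp only [Finset.mem_filter] at hZ ⊢
    exact ⟨hZ.1, lt_trans hY.2 hZ.2⟩
  · intro hsub
    have h2 := hsub (Finset.mem_filter.mpr ⟨hY.1, hY.2⟩)
    simp only [Finset.mem_filter] at h2
    exact lt_irrefl Y h2.2

/-- The characteristic polynomial `χ(A;t) = Σ_{X ∈ L(A)} μ(X) t^{dim X}`
of an arrangement inside the ambient space `T`. -/
def charPoly (T : Submodule K (Fin ℓ → K)) (A : Finset (Submodule K (Fin ℓ → K))) :
    Polynomial ℤ :=
  ∑ X ∈ latticeOf T A,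
    Polynomial.C (mob T (latticeOf T A) X) * Polynomial.X ^ (Module.finrank K X)

/-- The Betti number `b_i(A)`: `χ(A;t) = Σ (-1)^i b_i(A) t^{ℓ-i}`. -/
def bNum (A : Finset (Submodule K (Fin ℓ → K))) (i : ℕ) : ℤ :=
  (-1) ^ i * (charPoly (⊤ : Submodule K (Fin ℓ → K)) A).coeff (ℓ - i)

/-- Evaluation of the Poincaré polynomial `π(A;t) = Σ μ(X) (-t)^{codim X}` at `t : ℚ`. -/
def poincareEval (A : Finset (Submodule K (Fin ℓ → K))) (t : ℚ) : ℚ :=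
  ∑ X ∈ latticeOf ⊤ A,
    (mob (⊤ : Submodule K (Fin ℓ → K)) (latticeOf ⊤ A) X : ℚ) *
      (-t) ^ (ℓ - Module.finrank K X)

/-- The Euler derivation `θ_E = Σ xᵢ ∂/∂xᵢ`. -/
def eulerD : Deriv K ℓ := fun i => MvPolynomial.X i

/-- `A` is locally free: `A_X` is free for every `X ∈ L(A)` other than `∩_{H∈A} H`. -/
def LocallyFree (A : Finset (Submodule K (Fin ℓ → K))) : Prop :=
  ∀ X ∈ latticeOf ⊤ A, X ≠ A.inf id → IsFree (localize A X)

/-- Transport a finite set of subspaces contained in `T` to `K^m` along a linear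
isomorphism `T ≃ K^m`. -/
def transport {m : ℕ} (T : Submodule K (Fin ℓ → K)) (eqv : T ≃ₗ[K] (Fin m → K))
    (A : Finset (Submodule K (Fin ℓ → K))) : Finset (Submodule K (Fin m → K)) :=
  A.image fun L => (L.comap T.subtype).map eqv.toLinearMap

/-- An arrangement inside the subspace `T` is free with exponents `e`, i.e. it is free
after identifying `T` with a coordinate space. -/
def RestrFreeExp {m : ℕ} (T : Submodule K (Fin ℓ → K))
    (A : Finset (Submodule K (Fin ℓ → K))) (e : Fin m → ℕ) : Prop :=
  ∃ eqv : T ≃ₗ[K] (Fin m → K), IsFreeExp (transport T eqv A) e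

/-- The multiset of exponents. -/
def expMS {n : ℕ} (e : Fin n → ℕ) : Multiset ℕ := Finset.univ.val.map e

/-- `D(A)` has projective dimension at most 1: some finite generating set has a free
(possibly zero) syzygy module, i.e. there is a free resolution
`0 → S^m → S^n → D(A) → 0`. -/
def PdimLEOne (A : Finset (Submodule K (Fin ℓ → K))) : Prop :=
  ∃ (n m : ℕ) (θ : Fin n → Deriv K ℓ) (r : Fin m → Fin n → MvPolynomial (Fin ℓ) K),
    GeneratesD A θ ∧
    (∀ j, (∑ i, r j i • θ i) = 0) ∧
    (∀ c : Fin n → MvPolynomial (Fin ℓ) K, (∑ i, c i • θ i) = 0 →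
      ∃ q : Fin m → MvPolynomial (Fin ℓ) K, ∀ i, c i = ∑ j, q j * r j i) ∧
    (∀ q : Fin m → MvPolynomial (Fin ℓ) K, (∀ i, (∑ j, q j * r j i) = 0) → ∀ j, q j = 0)

/-- `A` has a free filtration `∅ = A₀ ⊂ A₁ ⊂ ⋯ ⊂ A_n = A`, `|A_i| = i`, each `A_i` free. -/
def HasFreeFiltration (A : Finset (Submodule K (Fin ℓ → K))) : Prop :=
  ∃ c : ℕ → Finset (Submodule K (Fin ℓ → K)),
    c A.card = A ∧ (∀ i ≤ A.card, (c i).card = i ∧ IsFree (c i)) ∧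
    ∀ i < A.card, c i ⊆ c (i + 1)

/-- The intersection lattices of `A` and `B` are isomorphic: there is a bijection of
hyperplanes preserving the rank of every subset (equivalently, a lattice isomorphism). -/
def LatticeEquiv (A B : Finset (Submodule K (Fin ℓ → K))) : Prop :=
  ∃ σ : Submodule K (Fin ℓ → K) → Submodule K (Fin ℓ → K),
    Set.BijOn σ ↑A ↑B ∧
    ∀ T ⊆ A, Module.finrank K ((T.inf id : Submodule K (Fin ℓ → K))) =
      Module.finrank K (((T.image σ).inf id : Submodule K (Fin ℓ → K)))


lemma eval_linPoly (φ : Module.Dual K (Fin ℓ → K)) (v : Fin ℓ → K) :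
    eval v (linPoly φ) = φ v := by
  conv_rhs => rw [← Finset.univ_sum_single v, map_sum]
  simp only [linPoly, map_sum, map_mul, eval_C, eval_X]
  refine Finset.sum_congr rfl fun i _ => ?_
  have : (Pi.single i (v i) : Fin ℓ → K) = v i • Pi.single i 1 := by
    rw [← Pi.single_smul]; simp
  rw [this, map_smul, smul_eq_mul, mul_comm]

lemma linPoly_hom (φ : Module.Dual K (Fin ℓ → K)) : (linPoly φ).IsHomogeneous 1 :=
  IsHomogeneous.sum _ _ _ fun i _ => isHomogeneous_C_mul_X _ _

lemma exists_coord {φ : Module.Dual K (Fin ℓ → K)} (h : φ ≠ 0) :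
    ∃ i, φ (Pi.single i 1) ≠ 0 := by
  by_contra! hc
  apply h
  apply LinearMap.pi_ext'
  intro i
  ext
  simpa using hc i

lemma linPoly_ne {φ : Module.Dual K (Fin ℓ → K)} (h : φ ≠ 0) : linPoly φ ≠ 0 := by
  intro h0
  apply h
  ext i
  simp [← eval_linPoly, h0]

lemma linPoly_smul (c : K) (φ : Module.Dual K (Fin ℓ → K)) :
    linPoly (c • φ) = C c * linPoly φ := by
  simp [linPoly, Finset.mul_sum, mul_assoc]

lemma applyLin_smul (c : K) (θ : Deriv K ℓ) (φ : Module.Dual K (Fin ℓ → K)) :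
    applyLin θ (c • φ) = C c * applyLin θ φ := by
  simp [applyLin, Finset.mul_sum, mul_assoc]

/-- `applyLin` as a linear map. -/
def appL (φ : Module.Dual K (Fin ℓ → K)) :
    Deriv K ℓ →ₗ[MvPolynomial (Fin ℓ) K] MvPolynomial (Fin ℓ) K where
  toFun θ := applyLin θ φ
  map_add' x y := by simp [applyLin, mul_add, Finset.sum_add_distrib]
  map_smul' c x := by
    simp only [applyLin, Finset.mul_sum, Pi.smul_apply, smul_eq_mul, RingHom.id_apply]
    exact Finset.sum_congr rfl fun i _ => by ring

/-- `D(A)` as a submodule. -/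
def DS (A : Finset (Submodule K (Fin ℓ → K))) :
    Submodule (MvPolynomial (Fin ℓ) K) (Deriv K ℓ) where
  carrier := {θ | InD A θ}
  zero_mem' := fun H _ φ _ => by
    have : applyLin (0 : Deriv K ℓ) φ = 0 := (appL φ).map_zero
    simp [this]
  add_mem' := fun {a b} ha hb H hH φ hφ => by
    have : applyLin (a + b) φ = applyLin a φ + applyLin b φ := (appL φ).map_add a b
    rw [this]; exact dvd_add (ha H hH φ hφ) (hb H hH φ hφ)
  smul_mem' := fun c a ha H hH φ hφ => by
    have : applyLin (c • a) φ = c * applyLin a φ := (appL φ).map_smul c a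
    rw [this]; exact (ha H hH φ hφ).mul_left c

lemma mem_DS {A : Finset (Submodule K (Fin ℓ → K))} {θ : Deriv K ℓ} :
    θ ∈ DS A ↔ InD A θ := Iff.rfl

lemma applyLin_hom {θ : Deriv K ℓ} {n : ℕ} (h : HomogDeriv θ n)
    (φ : Module.Dual K (Fin ℓ → K)) : (appL φ θ).IsHomogeneous n :=
  IsHomogeneous.sum _ _ _ fun i _ => (h i).C_mul _

lemma exists_sigma {ψ : Module.Dual K (Fin ℓ → K)} (h : ψ ≠ 0) :
    ∃ (τ : Type) (σ : MvPolynomial (Fin ℓ) K →+* MvPolynomial τ K),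
      Function.Surjective σ ∧ (∀ x, σ x = 0 ↔ linPoly ψ ∣ x) ∧
      (∀ p n, p.IsHomogeneous n → (σ p).IsHomogeneous n) ∧
      (∀ p, constantCoeff (σ p) = constantCoeff p) := by
  obtain ⟨i, hi⟩ := exists_coord h
  let g : Fin ℓ → MvPolynomial {k : Fin ℓ // k ≠ i} K := fun k =>
    if h : k ≠ i then X ⟨k, h⟩ else
      ∑ j : {k : Fin ℓ // k ≠ i}, C (-(ψ (Pi.single j.1 1) / ψ (Pi.single i 1))) * X j
  have hg1 : ∀ k, (g k).IsHomogeneous 1 := by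
    intro k
    by_cases hk : k ≠ i
    · simp only [g, dif_pos hk]; exact isHomogeneous_X _ _
    · simp only [g, dif_neg hk]
      exact IsHomogeneous.sum _ _ _ fun j _ => isHomogeneous_C_mul_X _ _
  have hgv : ∀ k : {k : Fin ℓ // k ≠ i}, g k.1 = X k := by
    intro k; simp only [g, dif_pos k.2]
  have hgi : g i = ∑ j : {k : Fin ℓ // k ≠ i},
      C (-(ψ (Pi.single j.1 1) / ψ (Pi.single i 1))) * X j := by
    simp [g]
  have hlin : linPoly ψ = C (ψ (Pi.single i 1)) * X i +
      ∑ j : {k : Fin ℓ // k ≠ i}, C (ψ (Pi.single j.1 1)) * X j.1 := by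
    rw [linPoly, ← Finset.add_sum_erase _ _ (Finset.mem_univ i)]
    congr 1
    exact Finset.sum_subtype (Finset.univ.erase i) (p := fun k => k ≠ i) (by simp)
      (fun j => C (ψ (Pi.single j 1)) * X j)
  let σ := aeval (R := K) g
  let ι := rename (R := K) (Subtype.val : {k : Fin ℓ // k ≠ i} → Fin ℓ)
  have hσι : ∀ t, σ (ι t) = t := by
    intro t
    have : σ.comp ι = AlgHom.id K _ := by
      apply MvPolynomial.algHom_ext
      intro k
      simp [σ, ι, hgv]
    exact DFunLike.congr_fun this t
  have hσψ : σ (linPoly ψ) = 0 := by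
    rw [hlin]
    simp only [map_add, map_mul, map_sum, σ, aeval_X, hgv, hgi]
    rw [Finset.mul_sum, ← Finset.sum_add_distrib]
    apply Finset.sum_eq_zero
    intro j _
    simp only [algHom_C, algebraMap_eq]
    rw [← mul_assoc, ← C_mul, ← add_mul, ← C_add]
    have : ψ (Pi.single i 1) * -(ψ (Pi.single j.1 1) / ψ (Pi.single i 1)) +
      ψ (Pi.single j.1 1) = 0 := by field_simp; ring
    rw [this]; simp
  have hmod : ∀ p, linPoly ψ ∣ p - ι (σ p) := by
    intro p
    rw [← Ideal.mem_span_singleton, ← Ideal.Quotient.eq]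
    have : (Ideal.Quotient.mkₐ K (Ideal.span {linPoly ψ})) =
      (Ideal.Quotient.mkₐ K (Ideal.span {linPoly ψ})).comp (ι.comp σ) := by
      apply MvPolynomial.algHom_ext
      intro k
      simp only [AlgHom.comp_apply, Ideal.Quotient.mkₐ_eq_mk]
      rw [Ideal.Quotient.eq, Ideal.mem_span_singleton]
      by_cases hk : k ≠ i
      · have := hgv ⟨k, hk⟩
        simp only at this
        simp [σ, ι, this]
      · push Not at hk
        subst hk
        refine ⟨C (ψ (Pi.single k 1))⁻¹, ?_⟩
        rw [hlin]
        simp only [σ, ι, aeval_X, hgi, map_sum, map_mul, rename_X, algHom_C, algebraMap_eq]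
        rw [add_mul, Finset.sum_mul, sub_eq_add_neg, ← Finset.sum_neg_distrib]
        congr 1
        · rw [mul_right_comm, ← C_mul, mul_inv_cancel₀ hi]; simp
        · refine Finset.sum_congr rfl fun j _ => ?_
          rw [mul_right_comm, ← C_mul, div_eq_mul_inv, C_neg]; simp
    exact DFunLike.congr_fun this p
  refine ⟨_, σ.toRingHom, fun t => ⟨ι t, hσι t⟩, fun x => ⟨fun hx => ?_, ?_⟩, ?_, ?_⟩
  · have := hmod x
    have hx' : σ x = 0 := hx
    simpa [hx'] using this
  · rintro ⟨y, rfl⟩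
    change σ _ = 0
    rw [map_mul, hσψ, zero_mul]
  · intro p n hp
    have := hp.aeval g hg1
    rw [one_mul] at this
    exact this
  · intro p
    have : (constantCoeff (σ := {k : Fin ℓ // k ≠ i}) (R := K)).comp σ.toRingHom
        = constantCoeff := by
      apply MvPolynomial.ringHom_ext
      · intro r; simp [σ]
      · intro k
        have := (hg1 k).coeff_eq_zero (d := 0) (by simp)
        simpa [σ, constantCoeff_eq] using this
    exact DFunLike.congr_fun this p

lemma linPoly_prime {ψ : Module.Dual K (Fin ℓ → K)} (h : ψ ≠ 0) : Prime (linPoly ψ) := by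
  obtain ⟨τ, σ, -, h2, -, -⟩ := exists_sigma h
  refine ⟨linPoly_ne h, ?_, ?_⟩
  · intro hu
    have := (h2 1).2 hu.dvd
    simp at this
  · intro a b hab
    rw [← h2, map_mul, mul_eq_zero, h2, h2] at hab
    exact hab

lemma ker_eq_smul {φ ψ : Module.Dual K (Fin ℓ → K)}
    (h : LinearMap.ker φ ≤ LinearMap.ker ψ) : ∃ c : K, ψ = c • φ := by
  have := mem_span_of_iInf_ker_le_ker (ι := Unit) (L := fun _ => φ) (K := ψ) (by simpa using h)
  simp only [Set.range_const, Submodule.mem_span_singleton] at this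
  obtain ⟨c, hc⟩ := this
  exact ⟨c, hc.symm⟩

lemma dvd_ker {φ ψ : Module.Dual K (Fin ℓ → K)}
    (h : linPoly φ ∣ linPoly ψ) : LinearMap.ker φ ≤ LinearMap.ker ψ := by
  obtain ⟨q, hq⟩ := h
  intro v hv
  rw [LinearMap.mem_ker] at *
  rw [← eval_linPoly, hq, map_mul, eval_linPoly, hv, zero_mul]

lemma mem_insert_DS {A : Finset (Submodule K (Fin ℓ → K))}
    {ψ : Module.Dual K (Fin ℓ → K)} (θ : Deriv K ℓ) :
    θ ∈ DS (insert (LinearMap.ker ψ) A) ↔ θ ∈ DS A ∧ linPoly ψ ∣ appL ψ θ := by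
  constructor
  · intro h
    exact ⟨fun H hH => h H (Finset.mem_insert_of_mem hH), h _ (Finset.mem_insert_self _ _) ψ rfl⟩
  · rintro ⟨h1, h2⟩ H hH φ hφ
    rcases Finset.mem_insert.1 hH with rfl | hH
    · obtain ⟨c, rfl⟩ := ker_eq_smul hφ.ge
      rw [linPoly_smul, applyLin_smul]
      exact mul_dvd_mul_left _ h2
    · exact h1 H hH φ hφ

lemma DS_sat {A : Finset (Submodule K (Fin ℓ → K))} (hA : IsArrangement A)
    {ψ : Module.Dual K (Fin ℓ → K)} (hψ : ψ ≠ 0) (hX : LinearMap.ker ψ ∉ A) (θ : Deriv K ℓ)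
    (h : linPoly ψ • θ ∈ DS A) : θ ∈ DS A := by
  intro H hH φ hφ
  have h1 : linPoly φ ∣ appL φ (linPoly ψ • θ) := h H hH φ hφ
  rw [map_smul, smul_eq_mul] at h1
  have hφ0 : φ ≠ 0 := by
    rintro rfl
    obtain ⟨φ', h0, h'⟩ := hA H hH
    apply h0
    rw [← LinearMap.ker_eq_top, h', ← hφ, LinearMap.ker_zero]
  rcases (linPoly_prime hφ0).dvd_or_dvd h1 with h2 | h2
  · exfalso
    obtain ⟨c, rfl⟩ := ker_eq_smul (dvd_ker h2)
    have hc : c ≠ 0 := by rintro rfl; simp at hψ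
    rw [LinearMap.ker_smul _ _ hc, hφ] at hX
    exact hX hH
  · exact h2

lemma split_unit {R M κ : Type*} [CommRing R] [IsDomain R] [AddCommGroup M] [Module R M]
    [Fintype κ] {n : ℕ} (D : Submodule R M) (ω : κ → M) (hω : ∀ k, ω k ∈ D)
    (r : κ → R) (hr : ∑ k, r k • ω k = 0) (hr0 : r ≠ 0)
    (hrel : ∀ p : κ → R, ∑ k, p k • ω k = 0 → ∃ q, ∀ k, p k = q * r k)
    (hgen : ∀ x ∈ D, ∃ p : κ → R, x = ∑ k, p k • ω k)
    (η : Fin n → M) (hη : ∀ i, η i ∈ D)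
    (hηgen : ∀ x ∈ D, ∃ c : Fin n → R, x = ∑ i, c i • η i)
    (hind : ∀ c : Fin n → R, ∑ i, c i • η i = 0 → ∀ i, c i = 0) :
    ∃ q : κ → R, ∑ k, r k * q k = 1 := by
  classical
  choose s hs using fun i => hgen (η i) (hη i)
  choose c hc using fun k => hηgen (ω k) (hω k)
  have h1 : ∀ k, ∃ q, ∀ l, (Pi.single k 1 : κ → R) l - ∑ i, c k i * s i l = q * r l := by
    intro k
    apply hrel
    simp only [sub_smul, Finset.sum_sub_distrib, Finset.sum_smul, mul_smul]
    rw [Finset.sum_comm]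
    simp only [← Finset.smul_sum, ← hs, ← hc]
    simp [Pi.single_apply, ite_smul]
  choose q hq using h1
  refine ⟨q, ?_⟩
  have h2 : ∀ i, ∑ k, r k * c k i = 0 := by
    apply hind
    simp only [Finset.sum_smul, mul_smul]
    rw [Finset.sum_comm]
    simp only [← Finset.smul_sum, ← hc]
    exact hr
  obtain ⟨l, hl⟩ := Function.ne_iff.1 hr0
  apply mul_right_cancel₀ hl
  rw [one_mul, Finset.sum_mul]
  have h3 : ∀ k, r k * q k * r l = r k * (Pi.single k 1 : κ → R) l
      - ∑ i, r k * c k i * s i l := by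
    intro k
    rw [mul_assoc, ← hq, mul_sub, Finset.mul_sum]
    simp only [mul_assoc]
  simp only [h3, Finset.sum_sub_distrib]
  rw [Finset.sum_comm]
  simp only [← Finset.sum_mul, h2]
  simp [Pi.single_apply]

lemma cyclic_quot {R T : Type*} {m n : ℕ} [CommRing R] [IsDomain R] [CommRing T] [IsDomain T]
    [UniqueFactorizationMonoid T] (σ : R →+* T) (hs : Function.Surjective σ)
    (p : R) (hp : p ≠ 0) (hσ : ∀ x, σ x = 0 ↔ p ∣ x)
    (L : (Fin m → R) →ₗ[R] R) (DA DB : Submodule R (Fin m → R))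
    (hDB : ∀ x, x ∈ DB ↔ x ∈ DA ∧ p ∣ L x)
    (hsat : ∀ x, p • x ∈ DA → x ∈ DA)
    (η : Fin n → Fin m → R) (hη : ∀ i, η i ∈ DB)
    (hηgen : ∀ x ∈ DB, ∃ c : Fin n → R, x = ∑ i, c i • η i)
    (hind : ∀ c : Fin n → R, ∑ i, c i • η i = 0 → ∀ i, c i = 0)
    (θ : Fin m → R) (hθ : θ ∈ DA) (hθB : θ ∉ DB) :
    ∃ φ ∈ DA, ∀ γ ∈ DA, ∃ t : R, γ - t • φ ∈ DB := by
  classical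
  let _ := UniqueFactorizationMonoid.strongNormalizationMonoid (α := T)
  let _ := UniqueFactorizationMonoid.toNormalizedGCDMonoid T
  have hpm : ∀ γ ∈ DA, ∃ c : Fin n → R, p • γ = ∑ i, c i • η i := by
    intro γ hγ
    apply hηgen
    rw [hDB]
    exact ⟨DA.smul_mem _ hγ, by simp⟩
  have hcancel : ∀ x y : Fin m → R, p • x = p • y → x = y := by
    intro x y h
    exact smul_right_injective _ hp h
  obtain ⟨c, hc⟩ := hpm θ hθ
  have hLθ : σ (L θ) ≠ 0 := by
    rw [Ne, hσ]; intro h; exact hθB ((hDB _).2 ⟨hθ, h⟩)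
  have hc0 : ∃ i, σ (c i) ≠ 0 := by
    by_contra! h
    simp only [hσ] at h
    choose w hw using h
    apply hθB
    have : θ = ∑ i, w i • η i := by
      apply hcancel
      rw [hc, Finset.smul_sum]
      simp only [smul_smul, ← hw]
    rw [this]
    exact Submodule.sum_mem _ fun i _ => DB.smul_mem _ (hη i)
  obtain ⟨i0, hi0⟩ := hc0
  obtain ⟨u, hu, hu1⟩ := Finset.extract_gcd (s := Finset.univ) (fun i => σ (c i)) ⟨i0, Finset.mem_univ _⟩
  set d := Finset.univ.gcd (fun i => σ (c i)) with hd
  have hd0 : d ≠ 0 := by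
    intro h
    apply hi0
    rw [hu i0 (Finset.mem_univ _), h, zero_mul]
  choose v hv using fun i => hs (u i)
  have hdiv : ∀ k, p ∣ (∑ i, v i • η i) k := by
    intro k
    rw [← hσ]
    apply mul_left_cancel₀ hd0
    have h1 : σ ((p • θ) k) = 0 := by rw [hσ]; simp
    rw [hc] at h1
    simp only [Finset.sum_apply, Pi.smul_apply, smul_eq_mul, map_sum, map_mul] at h1 ⊢
    rw [mul_zero, Finset.mul_sum, ← h1]
    refine Finset.sum_congr rfl fun i _ => ?_
    rw [hv, hu i (Finset.mem_univ _)]; ring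
  choose φ hφ using hdiv
  have hφ' : p • φ = ∑ i, v i • η i := by
    ext k; rw [hφ]; simp
  have hφA : φ ∈ DA := by
    apply hsat
    rw [hφ']
    exact Submodule.sum_mem _ fun i _ => DA.smul_mem _ ((hDB _).1 (hη i)).1
  refine ⟨φ, hφA, fun γ hγ => ?_⟩
  obtain ⟨b, hb⟩ := hpm γ hγ
  have hrel : ∀ i, σ (L θ) * σ (b i) = σ (L γ) * σ (c i) := by
    have h1 : L γ • θ - L θ • γ ∈ DB := by
      rw [hDB]
      refine ⟨DA.sub_mem (DA.smul_mem _ hθ) (DA.smul_mem _ hγ), ?_⟩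
      simp [mul_comm]
    obtain ⟨s, hs'⟩ := hηgen _ h1
    have h2 := hind (fun i => L γ * c i - L θ * b i - p * s i) (by
      simp only [sub_smul, mul_smul, Finset.sum_sub_distrib, ← Finset.smul_sum, ← hc, ← hb, ← hs']
      simp only [smul_sub, smul_smul]
      rw [mul_comm p (L γ), mul_comm p (L θ), sub_self])
    intro i
    have h3 := h2 i
    have h4 : σ (L γ * c i - L θ * b i - p * s i) = 0 := by rw [h3, map_zero]
    have h5 : σ p = 0 := (hσ p).2 dvd_rfl
    simp only [map_sub, map_mul, h5, zero_mul, sub_zero] at h4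
    exact (sub_eq_zero.1 h4).symm
  have hdvd : σ (L θ) ∣ σ (L γ) * d := by
    have h1 : σ (L θ) ∣ Finset.univ.gcd (fun i => σ (L γ) * d * u i) := by
      apply Finset.dvd_gcd
      intro i _
      refine ⟨σ (b i), ?_⟩
      rw [hrel, hu i (Finset.mem_univ _)]; ring
    have h2 := (Finset.gcd_mul_left' (s := Finset.univ) (f := u) (σ (L γ) * d))
    rw [hu1, mul_one] at h2
    exact h1.trans h2.dvd
  obtain ⟨t, ht⟩ := hdvd
  obtain ⟨t', rfl⟩ := hs t
  have hbt : ∀ i, p ∣ b i - t' * v i := by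
    intro i
    rw [← hσ, map_sub, map_mul, sub_eq_zero]
    apply mul_left_cancel₀ hLθ
    rw [hrel, hu i (Finset.mem_univ _), hv, ← mul_assoc, ← mul_assoc, ht]
  choose w hw using hbt
  refine ⟨t', ?_⟩
  have : γ - t' • φ = ∑ i, w i • η i := by
    apply hcancel
    rw [smul_sub, hb, smul_comm, hφ', Finset.smul_sum, Finset.smul_sum, ← Finset.sum_sub_distrib]
    refine Finset.sum_congr rfl fun i _ => ?_
    rw [smul_smul, smul_smul, ← sub_smul, hw]
  rw [this]
  exact Submodule.sum_mem _ fun i _ => DB.smul_mem _ (hη i)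

/-- all monomials have degree at least `m` -/
lemma low_mul {τ : Type} (c a : MvPolynomial τ K) (m n : ℕ) (ha : a.IsHomogeneous n)
    (hmn : m ≤ n) (d : τ →₀ ℕ) (hd : d.degree < m) : coeff d (c * a) = 0 := by
  rw [coeff_mul]
  apply Finset.sum_eq_zero
  rintro ⟨x, y⟩ hxy
  rw [Finset.HasAntidiagonal.mem_antidiagonal] at hxy
  have : y.degree ≠ n := by
    have : x.degree + y.degree = d.degree := by rw [← hxy]; simp
    omega
  rw [ha.coeff_eq_zero this, mul_zero]

lemma const_of_low {τ : Type} (a0 a t : MvPolynomial τ K) (m : ℕ) (ha : a.IsHomogeneous m)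
    (ha0 : a ≠ 0) (hlow : ∀ d : τ →₀ ℕ, d.degree < m → coeff d a0 = 0) (h : a = t * a0) :
    ∃ k : K, k ≠ 0 ∧ t = C k := by
  have ht0 : t ≠ 0 := by rintro rfl; simp at h; exact ha0 h
  have h00 : a0 ≠ 0 := by rintro rfl; simp at h; exact ha0 h
  have h1 := totalDegree_mul_of_isDomain ht0 h00
  rw [← h, ha.totalDegree ha0] at h1
  obtain ⟨d, hd⟩ := ne_zero_iff.1 h00
  have h2 : m ≤ d.degree := by
    by_contra! h3; exact hd (hlow d h3)
  have h3 : d.degree ≤ a0.totalDegree := by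
    have := le_totalDegree (mem_support_iff.2 hd)
    exact this
  have h4 : t.totalDegree = 0 := by omega
  rw [totalDegree_eq_zero_iff_eq_C] at h4
  refine ⟨_, ?_, h4⟩
  intro h5
  rw [h5] at h4; simp at h4; exact ht0 h4

lemma alpha_of_dvd {α : MvPolynomial (Fin ℓ) K} (hα : α.IsHomogeneous 1) (hα0 : α ≠ 0)
    {ψ : Module.Dual K (Fin ℓ → K)} (hψ : ψ ≠ 0) (h : linPoly ψ ∣ α) :
    ∃ c : K, c ≠ 0 ∧ α = C c * linPoly ψ := by
  obtain ⟨q, hq⟩ := h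
  rw [mul_comm] at hq
  obtain ⟨k, hk, hqk⟩ := const_of_low (linPoly ψ) α q 1 hα hα0
    (fun d hd => (linPoly_hom ψ).coeff_eq_zero (by omega)) hq
  exact ⟨k, hk, by rw [hq, hqk]⟩

lemma hom_const {τ : Type} {f : MvPolynomial τ K} {n : ℕ} (h : f.IsHomogeneous n) (hn : n ≠ 0) :
    constantCoeff f = 0 := by
  rw [constantCoeff_eq]
  exact h.coeff_eq_zero (by simpa using hn.symm)

/-- Generation by the `θ`'s modulo `D(B)` -/
lemma theta_generates {A : Finset (Submodule K (Fin ℓ → K))} (hA : IsArrangement A)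
    {e : Fin ℓ → ℕ} {lev : ℕ} {θ : Fin ℓ → Deriv K ℓ} {φ : Deriv K ℓ}
    {f : Fin ℓ → MvPolynomial (Fin ℓ) K} {α : MvPolynomial (Fin ℓ) K}
    (hP : IsPOGWith A e lev θ φ f α)
    {ψ : Module.Dual K (Fin ℓ → K)} (hψ : ψ ≠ 0) (hX : LinearMap.ker ψ ∉ A)
    (hfree : IsFree (insert (LinearMap.ker ψ) A))
    (j : Fin ℓ) (hj : θ j ∉ DS (insert (LinearMap.ker ψ) A))
    (hmin : ∀ i, θ i ∉ DS (insert (LinearMap.ker ψ) A) → e j ≤ e i) (hjl : e j < lev) :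
    (∀ i, ∃ g : MvPolynomial (Fin ℓ) K, θ i - g • θ j ∈ DS (insert (LinearMap.ker ψ) A)) ∧
    (∃ g : MvPolynomial (Fin ℓ) K, constantCoeff g = 0 ∧ φ - g • θ j ∈ DS (insert (LinearMap.ker ψ) A)) := by
  obtain ⟨hθ, hφ, hθh, hφh, hgen, -⟩ := hP
  obtain ⟨b, η, -, ⟨hη, hηgen⟩, hind⟩ := hfree
  obtain ⟨τ, σ, hs, hσ, hσh, hσc⟩ := exists_sigma hψ
  obtain ⟨φ0, hφ0, hcyc⟩ := cyclic_quot σ hs (linPoly ψ) (linPoly_ne hψ) hσ (appL ψ) (DS A)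
    (DS (insert (LinearMap.ker ψ) A)) mem_insert_DS (DS_sat hA hψ hX) η hη hηgen hind (θ j)
    (hθ j) hj
  have hB : ∀ x ∈ DS A, x ∈ DS (insert (LinearMap.ker ψ) A) ↔ σ (appL ψ x) = 0 := by
    intro x hx
    rw [mem_insert_DS, hσ]; tauto
  have hj0 : σ (appL ψ (θ j)) ≠ 0 := fun h => hj ((hB _ (hθ j)).2 h)
  have hcycσ : ∀ x (t : MvPolynomial (Fin ℓ) K),
      x - t • φ0 ∈ DS (insert (LinearMap.ker ψ) A) → σ (appL ψ x) = σ t * σ (appL ψ φ0) := by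
    intro x t h
    have := (mem_insert_DS _).1 h |>.2
    rw [← hσ, map_sub, map_sub, map_smul, smul_eq_mul, map_mul, sub_eq_zero] at this
    exact this
  have hlow : ∀ d : τ →₀ ℕ, d.degree < e j → coeff d (σ (appL ψ φ0)) = 0 := by
    intro d hd
    obtain ⟨c, g, hcg⟩ := hgen φ0 hφ0
    rw [hcg]
    simp only [map_add, map_sum, map_smul, smul_eq_mul, map_mul, coeff_add, coeff_sum]
    rw [low_mul _ _ _ _ (hσh _ _ (applyLin_hom hφh ψ)) hjl.le d hd, add_zero]
    apply Finset.sum_eq_zero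
    intro i _
    by_cases hi : θ i ∈ DS (insert (LinearMap.ker ψ) A)
    · rw [(hB _ (hθ i)).1 hi]; simp
    · exact low_mul _ _ _ _ (hσh _ _ (applyLin_hom (hθh i) ψ)) (hmin i hi) d hd
  obtain ⟨tj, htj⟩ := hcyc (θ j) (hθ j)
  obtain ⟨k, hk, hkt⟩ := const_of_low _ _ _ (e j) (hσh _ _ (applyLin_hom (hθh j) ψ)) hj0 hlow
    (hcycσ _ _ htj)
  have main : ∀ x ∈ DS A, ∃ g : MvPolynomial (Fin ℓ) K, x - g • θ j ∈ DS (insert (LinearMap.ker ψ) A) := by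
    intro x hx
    obtain ⟨t, ht⟩ := hcyc x hx
    refine ⟨t * C k⁻¹, ?_⟩
    rw [hB _ ((DS A).sub_mem hx ((DS A).smul_mem _ (hθ j)))]
    obtain ⟨kk, hkk⟩ : ∃ kk, kk = σ (C k⁻¹) := ⟨_, rfl⟩
    have hk1 : σ (C k⁻¹) * C k = 1 := by
      have h0 : (σ (C k⁻¹)).IsHomogeneous 0 := hσh _ _ (isHomogeneous_C _ _)
      have h1 := hσc (C k⁻¹)
      rw [← totalDegree_zero_iff_isHomogeneous, totalDegree_eq_zero_iff_eq_C] at h0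
      rw [constantCoeff_eq, constantCoeff_C] at h1
      rw [h0, h1, ← C_mul, inv_mul_cancel₀ hk, C_1]
    rw [map_sub, map_sub, map_smul, smul_eq_mul, map_mul, map_mul, hcycσ _ _ ht, hcycσ _ _ htj, hkt]
    linear_combination (-σ t * σ (appL ψ φ0)) * hk1
  refine ⟨fun i => main _ (hθ i), ?_⟩
  obtain ⟨g, hg⟩ := main φ hφ
  refine ⟨g, ?_, hg⟩
  have h1 := (mem_insert_DS _).1 hg |>.2
  rw [← hσ, map_sub, map_sub, map_smul, smul_eq_mul, map_mul, sub_eq_zero] at h1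
  rw [← hσc]
  by_contra hne
  have haj := hσh _ _ (applyLin_hom (hθh j) ψ)
  obtain ⟨d, hd⟩ := ne_zero_iff.1 hj0
  have hdd : d.degree = e j := by
    by_contra h; exact hd (haj.coeff_eq_zero h)
  have h2 : coeff d (σ (appL ψ φ)) = 0 :=
    (hσh _ _ (applyLin_hom hφh ψ)).coeff_eq_zero (by omega)
  have h3 : σ g = (σ g - C (constantCoeff (σ g))) + C (constantCoeff (σ g)) := by ring
  rw [h1, h3, add_mul, coeff_add, coeff_C_mul, coeff_mul] at h2
  rw [Finset.sum_eq_zero, zero_add, mul_eq_zero] at h2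
  · tauto
  · rintro ⟨x, y⟩ hxy
    rw [Finset.HasAntidiagonal.mem_antidiagonal] at hxy
    by_cases hx : x = 0
    · subst hx; simp [constantCoeff_eq]
    · have : y.degree ≠ e j := by
        have h4 : x.degree + y.degree = d.degree := by rw [← hxy]; simp
        have h5 : x.degree ≠ 0 := by simpa [Finsupp.degree_eq_zero_iff] using hx
        omega
      rw [haj.coeff_eq_zero this, mul_zero]

lemma key {A : Finset (Submodule K (Fin ℓ → K))} (hA : IsArrangement A)
    {e : Fin ℓ → ℕ} {lev : ℕ} {θ : Fin ℓ → Deriv K ℓ} {φ : Deriv K ℓ}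
    {f : Fin ℓ → MvPolynomial (Fin ℓ) K} {α : MvPolynomial (Fin ℓ) K}
    (hP : IsPOGWith A e lev θ φ f α) (hα0 : α ≠ 0) (hlev : ∀ i, e i < lev)
    {ψ : Module.Dual K (Fin ℓ → K)} (hψ : ψ ≠ 0) (hX : LinearMap.ker ψ ∉ A)
    (hfree : IsFree (insert (LinearMap.ker ψ) A)) :
    ∃ c : K, c ≠ 0 ∧ α = C c * linPoly ψ := by
  have hP' := hP
  obtain ⟨hθ, hφ, hθh, hφh, hgen, hα, hf, hf0, hrel, -, hsyz⟩ := hP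
  have hfree' := hfree
  obtain ⟨b, η, -, ⟨hη, hηgen⟩, hind⟩ := hfree'
  have hαc : constantCoeff α = 0 := hom_const hα one_ne_zero
  by_cases hall : ∀ i, θ i ∈ DS (insert (LinearMap.ker ψ) A)
  · have hφB : φ ∉ DS (insert (LinearMap.ker ψ) A) := by
      intro hφB
      obtain ⟨q, hq⟩ := split_unit (κ := Option (Fin ℓ)) (DS (insert (LinearMap.ker ψ) A))
        (fun o => o.elim φ θ) (by rintro (_ | i); exacts [hφB, hall i])
        (fun o => o.elim α f) (by simpa [Fintype.sum_option, add_comm] using hrel)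
        (fun h => hα0 (congrFun h none))
        (by
          intro p hp
          obtain ⟨q, h1, h2⟩ := hsyz (fun i => p (some i)) (p none)
            (by simpa [Fintype.sum_option, add_comm] using hp)
          exact ⟨q, by rintro (_ | i); exacts [h2, h1 i]⟩)
        (by
          intro x hx
          obtain ⟨c, g, hcg⟩ := hgen x ((mem_insert_DS x).1 hx).1
          refine ⟨fun o => o.elim g c, ?_⟩
          rw [hcg]; simp [Fintype.sum_option, add_comm])
        η hη hηgen hind
      have := congrArg constantCoeff hq
      simp [Fintype.sum_option, hαc, hf0] at this
    have h1 : α • φ ∈ DS (insert (LinearMap.ker ψ) A) := by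
      rw [eq_neg_of_add_eq_zero_right hrel]
      exact Submodule.neg_mem _ (Submodule.sum_mem _ fun i _ => Submodule.smul_mem _ _ (hall i))
    have h2 := ((mem_insert_DS _).1 h1).2
    rw [map_smul, smul_eq_mul] at h2
    rcases (linPoly_prime hψ).dvd_or_dvd h2 with h3 | h3
    · exact alpha_of_dvd hα hα0 hψ h3
    · exact absurd ((mem_insert_DS _).2 ⟨hφ, h3⟩) hφB
  · exfalso
    push Not at hall
    obtain ⟨j, hj, hmin⟩ : ∃ j, θ j ∉ DS (insert (LinearMap.ker ψ) A) ∧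
        ∀ i, θ i ∉ DS (insert (LinearMap.ker ψ) A) → e j ≤ e i := by
      obtain ⟨i0, hi0⟩ := hall
      obtain ⟨j, hj, hm⟩ := Finset.exists_min_image
        (Finset.univ.filter fun i => θ i ∉ DS (insert (LinearMap.ker ψ) A)) e
        ⟨i0, by simpa using hi0⟩
      exact ⟨j, by simpa using hj, fun i hi => hm i (by simpa using hi)⟩
    obtain ⟨hg1, g, hg0, hg⟩ := theta_generates hA hP' hψ hX hfree j hj hmin (hlev j)
    choose G hG using hg1
    have hpB : ∀ k : MvPolynomial (Fin ℓ) K,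
        k • θ j ∈ DS (insert (LinearMap.ker ψ) A) → linPoly ψ ∣ k := by
      intro k hk
      have h2 := ((mem_insert_DS _).1 hk).2
      rw [map_smul, smul_eq_mul] at h2
      rcases (linPoly_prime hψ).dvd_or_dvd h2 with h3 | h3
      · exact h3
      · exact absurd ((mem_insert_DS _).2 ⟨hθ j, h3⟩) hj
    have hpj : linPoly ψ • θ j ∈ DS (insert (LinearMap.ker ψ) A) := by
      rw [mem_insert_DS]
      exact ⟨(DS A).smul_mem _ (hθ j), by simp⟩
    -- new generators
    let s : Finset (Fin ℓ) := Finset.univ.erase j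
    let ω : Fin ℓ → Deriv K ℓ := fun i =>
      if i = j then linPoly ψ • θ j else θ i - G i • θ j
    have hωj : ω j = linPoly ψ • θ j := by simp [ω]
    have hωs : ∀ i ∈ s, ω i = θ i - G i • θ j := by
      intro i hi
      simp [ω, (Finset.mem_erase.1 hi).1]
    have hωB : ∀ i, ω i ∈ DS (insert (LinearMap.ker ψ) A) := by
      intro i
      by_cases hi : i = j
      · subst hi; rw [hωj]; exact hpj
      · rw [hωs i (by simp [s, hi])]; exact hG i
    -- expansion identity
    have hexp : ∀ (c : Fin ℓ → MvPolynomial (Fin ℓ) K) (k : MvPolynomial (Fin ℓ) K),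
        (∑ i, c i • θ i) + k • φ =
          (∑ i ∈ s, c i • ω i) + k • (φ - g • θ j) +
            (c j + ∑ i ∈ s, c i * G i + k * g) • θ j := by
      intro c k
      rw [← Finset.add_sum_erase _ _ (Finset.mem_univ j)]
      have : ∑ i ∈ s, c i • ω i = ∑ i ∈ s, c i • θ i - (∑ i ∈ s, c i * G i) • θ j := by
        rw [Finset.sum_smul, ← Finset.sum_sub_distrib]
        refine Finset.sum_congr rfl fun i hi => ?_
        rw [hωs i hi, smul_sub, smul_smul]
      rw [this, add_smul, add_smul, smul_sub, smul_smul]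
      simp only [s]
      abel
    have hsB : ∀ (c : Fin ℓ → MvPolynomial (Fin ℓ) K) (k : MvPolynomial (Fin ℓ) K),
        (∑ i ∈ s, c i • ω i) + k • (φ - g • θ j) ∈ DS (insert (LinearMap.ker ψ) A) := by
      intro c k
      exact Submodule.add_mem _ (Submodule.sum_mem _ fun i _ => Submodule.smul_mem _ _ (hωB i))
        (Submodule.smul_mem _ _ hg)
    have hdv : ∀ (c : Fin ℓ → MvPolynomial (Fin ℓ) K) (k : MvPolynomial (Fin ℓ) K),
        (∑ i, c i • θ i) + k • φ ∈ DS (insert (LinearMap.ker ψ) A) →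
        linPoly ψ ∣ c j + ∑ i ∈ s, c i * G i + k * g := by
      intro c k h
      apply hpB
      rw [hexp] at h
      exact (Submodule.add_mem_iff_right _ (hsB c k)).1 h
    obtain ⟨r, hr⟩ := hdv f α (by rw [hrel]; exact Submodule.zero_mem _)
    have hsumω : ∀ (c : Fin ℓ → MvPolynomial (Fin ℓ) K) (x : MvPolynomial (Fin ℓ) K),
        ∑ i, (Function.update c j x) i • ω i = x • linPoly ψ • θ j + ∑ i ∈ s, c i • ω i := by
      intro c x
      rw [← Finset.add_sum_erase _ _ (Finset.mem_univ j), hωj]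
      congr 1
      · simp
      · refine Finset.sum_congr rfl fun i hi => ?_
        rw [Function.update_of_ne (Finset.mem_erase.1 hi).1]
    have hr0 : constantCoeff r = 0 := by
      obtain ⟨i, hi⟩ := exists_coord hψ
      have h1 := congrArg (fun p => constantCoeff (pderiv i p)) hr
      have hfd : ∀ k, constantCoeff (pderiv i (f k)) = 0 := by
        intro k
        have := hlev k
        exact hom_const (hf k).pderiv (by omega)
      have hψ0 : constantCoeff (linPoly ψ) = 0 := hom_const (linPoly_hom ψ) one_ne_zero
      have hψd : constantCoeff (pderiv i (linPoly ψ)) = ψ (Pi.single i 1) := by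
        simp [linPoly, pderiv_X, Pi.single_apply]
      simp [Derivation.leibniz, hfd, hf0, hαc, hg0, hψ0, hψd] at h1
      tauto
    obtain ⟨q, hq⟩ := split_unit (κ := Option (Fin ℓ)) (DS (insert (LinearMap.ker ψ) A))
        (fun o => o.elim (φ - g • θ j) ω) (by rintro (_ | i); exacts [hg, hωB i])
        (fun o => o.elim α (Function.update f j r))
        (by
          have h1 := hrel
          rw [hexp, hr] at h1
          simp only [Fintype.sum_option, Option.elim, hsumω]
          rw [← h1, smul_smul, mul_comm r]
          abel)
        (fun h => hα0 (congrFun h none))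
        (by
          intro p hp
          let c : Fin ℓ → MvPolynomial (Fin ℓ) K := Function.update (fun i => p (some i)) j
            (linPoly ψ * p (some j) - ∑ i ∈ s, p (some i) * G i - p none * g)
          have hcs : ∀ i ∈ s, c i = p (some i) := fun i hi =>
            Function.update_of_ne (Finset.mem_erase.1 hi).1 _ _
          have hcj : c j = linPoly ψ * p (some j) - ∑ i ∈ s, p (some i) * G i - p none * g :=
            Function.update_self _ _ _
          have hsG : ∑ i ∈ s, c i * G i = ∑ i ∈ s, p (some i) * G i :=
            Finset.sum_congr rfl fun i hi => by rw [hcs i hi]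
          have hsO : ∑ i ∈ s, c i • ω i = ∑ i ∈ s, p (some i) • ω i :=
            Finset.sum_congr rfl fun i hi => by rw [hcs i hi]
          obtain ⟨q, h1, h2⟩ := hsyz c (p none) (by
            rw [hexp, hcj]
            rw [hsG, hsO]
            rw [Fintype.sum_option, ← Finset.add_sum_erase _ _ (Finset.mem_univ j)] at hp
            simp only [Option.elim, hωj] at hp
            rw [← hp, show linPoly ψ * p (some j) - ∑ i ∈ s, p (some i) * G i - p none * g +
              ∑ i ∈ s, p (some i) * G i + p none * g = p (some j) * linPoly ψ by ring, mul_smul]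
            simp only [s]
            abel)
          refine ⟨q, ?_⟩
          rintro (_ | i)
          · exact h2
          · by_cases hi : i = j
            · subst hi
              simp only [Option.elim, Function.update_self]
              apply mul_left_cancel₀ (linPoly_ne hψ)
              have h3 : linPoly ψ * p (some i) =
                  c i + ∑ k ∈ s, c k * G k + p none * g := by
                rw [hcj, hsG]
                ring
              rw [h3, h1 i, h2, mul_left_comm, ← hr, mul_add, mul_add, Finset.mul_sum]
              congr 1
              · congr 1
                refine Finset.sum_congr rfl fun k _ => ?_
                rw [h1 k]; ring
              · ring
            · simp only [Option.elim, Function.update_of_ne hi]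
              rw [← h1, hcs i (by simp [s, hi])])
        (by
          intro x hx
          obtain ⟨c, k, hck⟩ := hgen x ((mem_insert_DS x).1 hx).1
          obtain ⟨y, hy⟩ := hdv c k (by rw [← hck]; exact hx)
          refine ⟨fun o => o.elim k (Function.update c j y), ?_⟩
          simp only [Fintype.sum_option, Option.elim, hsumω]
          rw [hck, hexp, hy, smul_smul, mul_comm y]
          abel)
        η hη hηgen hind
    have := congrArg constantCoeff hq
    have h0 : ∀ i, constantCoeff (Function.update f j r i) = 0 := by
      intro i
      by_cases hi : i = j
      · subst hi; simpa using hr0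
      · rw [Function.update_of_ne hi]; exact hf0 i
    simp [Fintype.sum_option, hαc, h0] at this

/-- Theorem `numberfa`: let `A` be next to free minus, hence
strictly plus-one generated with `POexp(A) = (d₁,…,d_ℓ)` and level `d`. If `d > dᵢ`
for all `i`, then `A` admits exactly one free addition: there is a unique hyperplane
`X ∉ A` such that `A ∪ {X}` is free. -/
theorem unique_free_addition {K : Type} [Field K] {ℓ : ℕ}
    (A : Finset (Submodule K (Fin ℓ → K)))
    (hA : IsArrangement A) (hEss : Essential A)
    (hntf : ∃ (B : Finset (Submodule K (Fin ℓ → K))) (H : Submodule K (Fin ℓ → K)),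
      IsArrangement B ∧ Essential B ∧ IsFree B ∧ H ∈ B ∧ A = B.erase H)
    (e : Fin ℓ → ℕ) (lev : ℕ) (hspog : IsSPOG A e lev)
    (hlev : ∀ i, e i < lev) :
    ∃! X : Submodule K (Fin ℓ → K),
      (∃ ψ : Module.Dual K (Fin ℓ → K), ψ ≠ 0 ∧ LinearMap.ker ψ = X) ∧
        X ∉ A ∧ IsFree (insert X A) := by
  obtain ⟨B, H, hB, -, hBf, hHB, rfl⟩ := hntf
  obtain ⟨θ, φ, f, α, hP, hα0⟩ := hspog
  have hins : insert H (B.erase H) = B := Finset.insert_erase hHB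
  have hex : (∃ ψ : Module.Dual K (Fin ℓ → K), ψ ≠ 0 ∧ LinearMap.ker ψ = H) ∧
        H ∉ B.erase H ∧ IsFree (insert H (B.erase H)) :=
    ⟨hB H hHB, Finset.notMem_erase _ _, by rw [hins]; exact hBf⟩
  refine ⟨H, hex, ?_⟩
  rintro Y ⟨⟨ψ, hψ, rfl⟩, hY, hYf⟩
  obtain ⟨⟨ψ', hψ', rfl⟩, hH, hHf⟩ := hex
  obtain ⟨c, hc, h1⟩ := key hA hP hα0 hlev hψ hY hYf
  obtain ⟨c', hc', h2⟩ := key hA hP hα0 hlev hψ' hH hHf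
  ext v
  have h3 := congrArg (eval v) (h1.symm.trans h2)
  simp only [map_mul, eval_C, eval_linPoly] at h3
  rw [LinearMap.mem_ker, LinearMap.mem_ker]
  constructor
  · intro h
    rw [h, mul_zero] at h3
    exact (mul_eq_zero.1 h3.symm).resolve_left hc'
  · intro h
    rw [h, mul_zero] at h3
    exact (mul_eq_zero.1 h3).resolve_left hc

end ArrPOG
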